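/- Let m, n, k_L, k_R be non-negative integers with k_L ≤ n, k_R ≤ n and n+1 ≤ k_L + k_R, and let b_{n−k_R+1} < b_{n−k_R+2} < … < b_{k_L} be positive integers that can occur as the bottom row of an (m,n,k_L,k_R)-Gog pentagon (in particular j ≤ b_j ≤ m+j for n−k_R+1 ≤ j ≤ k_L). Then the number of (m,n,k_L,k_R)-Gog pentagons with bottom row (b_{n−k_R+1},…,b_{k_L}) equals the constant term in x_1,…,x_n of the Laurent polynomial (−1)^{C(n−k_R,2)} · ∏_{i=1}^{n−k_R} (1+x_i)^{i} x_i^{1−k_R−i} · ∏_{i=n−k_R+1}^{k_L} (1+x_i)^{b_i} x_i^{−n+1} · ∏_{i=k_L+1}^{n} (1+x_i)^{m+k_L+1} x_i^{−n+i−k_L} · ∏_{1≤i<j≤n} (x_i − x_j)(1 + x_j + x_i x_j), where C(n−k_R,2) denotes the binomial coefficient (n−k_R choose 2). -/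

import Mathlib

open scoped BigOperators

/-- The position `(i,j)` (row `i`, `j`-th entry, 1-based) belongs to the shape of an
`(m,n,k_L,k_R)`-Gog pentagon: `1 ≤ i ≤ n` and `max(1, i−k_R+1) ≤ j ≤ min(i, k_L)`. -/
def PentPos (n kL kR i j : ℕ) : Prop :=
  1 ≤ i ∧ i ≤ n ∧ 1 ≤ j ∧ i + 1 ≤ j + kR ∧ j ≤ i ∧ j ≤ kL

/-- An `(m,n,k_L,k_R)`-Gog pentagon, encoded as `a : ℕ → ℕ → ℤ` (zero off the shape):
weak increase along NE- and SE-diagonals, strict increase along rows, entries of the `j`-th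
NE-diagonal bounded below by `j` and entries of the `i`-th SE-diagonal (counted from the right)
bounded above by `m+n+1−i`, i.e. `j ≤ a i j ≤ m+n−i+j`. -/
def IsPent (m n kL kR : ℕ) (a : ℕ → ℕ → ℤ) : Prop :=
  (∀ i j, PentPos n kL kR i j → (j : ℤ) ≤ a i j ∧ a i j ≤ ((m + (n - i) + j : ℕ) : ℤ)) ∧
  (∀ i j, PentPos n kL kR i j → PentPos n kL kR (i+1) j → a (i+1) j ≤ a i j) ∧
  (∀ i j, PentPos n kL kR i j → PentPos n kL kR (i+1) (j+1) → a i j ≤ a (i+1) (j+1)) ∧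
  (∀ i j, PentPos n kL kR i j → PentPos n kL kR i (j+1) → a i j < a i (j+1)) ∧
  (∀ i j, ¬ PentPos n kL kR i j → a i j = 0)

/-- The exponent vector with `x_i`-entry `k_R+i−1` for `1 ≤ i ≤ n−k_R`, `n−1` for
`n−k_R < i ≤ k_L` and `n+k_L−i` for `k_L < i ≤ n`: taking this coefficient amounts to taking
the constant term after multiplying by
`∏_{i=1}^{n−k_R} x_i^{1−k_R−i} ∏_{i=n−k_R+1}^{k_L} x_i^{−n+1} ∏_{i=k_L+1}^{n} x_i^{−n+i−k_L}`. -/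
noncomputable def pentDeg (n kL kR : ℕ) : ℕ →₀ ℕ :=
  (∑ i ∈ Finset.Icc 1 (n - kR), Finsupp.single i (kR + i - 1)) +
    (∑ i ∈ Finset.Icc (n - kR + 1) kL, Finsupp.single i (n - 1)) +
    ∑ i ∈ Finset.Icc (kL + 1) n, Finsupp.single i (n + kL - i)


/-- The coefficient of `∏ X_i ^ d_i`. -/
noncomputable def coeffAt {n : ℕ} (d : Fin n → ℕ) (P : MvPolynomial (Fin n) ℚ) : ℚ :=
  MvPolynomial.coeff (Finsupp.equivFunOnFinite.symm d) P

/-- The product of `w i j` over all pairs `i < j`. -/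
noncomputable def pairProd {M : Type*} [CommMonoid M] (n : ℕ) (w : Fin n → Fin n → M) : M :=
  ∏ i, ∏ j, if i < j then w i j else 1

/-- The pair factor `(x - y) (1 + y + x y)`. -/
def pairFactor {R : Type*} [CommRing R] (x y : R) : R := (x - y) * (1 + y + x * y)

/-- The product of all pair factors of the variables. -/
noncomputable def pairPoly (n : ℕ) : MvPolynomial (Fin n) ℚ :=
  pairProd n fun i j => pairFactor (MvPolynomial.X i) (MvPolynomial.X j)

section pairProd

variable {M : Type*} [CommMonoid M]

theorem pairProd_mul (n : ℕ) (v w : Fin n → Fin n → M) :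
    (pairProd n fun i j => v i j * w i j) = pairProd n v * pairProd n w := by
  simp only [pairProd, ← Finset.prod_mul_distrib]
  refine Finset.prod_congr rfl fun i _ => Finset.prod_congr rfl fun j _ => ?_
  split_ifs <;> simp

theorem pairProd_succAbove (n : ℕ) (w : Fin (n + 1) → Fin (n + 1) → M) (r : Fin (n + 1)) :
    pairProd (n + 1) w =
      (∏ i : Fin n, if (i : ℕ) < r then w (r.succAbove i) r else w r (r.succAbove i)) *
        pairProd n fun i j => w (r.succAbove i) (r.succAbove j) := by
  have h1 (i : Fin n) : r < r.succAbove i ↔ ¬ (i : ℕ) < r := by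
    rw [Fin.lt_succAbove_iff_le_castSucc, Fin.le_def]; simp
  have h2 (i : Fin n) : r.succAbove i < r ↔ (i : ℕ) < r := by
    rw [Fin.succAbove_lt_iff_castSucc_lt, Fin.lt_def]; simp
  simp only [pairProd]
  rw [Fin.prod_univ_succAbove _ r, Fin.prod_univ_succAbove _ r]
  simp only [lt_irrefl, if_false, one_mul]
  rw [Finset.prod_congr rfl fun i _ => Fin.prod_univ_succAbove _ r, Finset.prod_mul_distrib,
    ← mul_assoc, ← Finset.prod_mul_distrib]
  simp only [h1, h2, Fin.succAbove_lt_succAbove_iff]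
  congr 1
  refine Finset.prod_congr rfl fun i _ => ?_
  by_cases h : (i : ℕ) < r <;> simp [h]

theorem pairProd_adjacent_swap (n : ℕ) (w : Fin n → Fin n → M) {i j : Fin n}
    (hij : (j : ℕ) = i + 1) :
    (pairProd n fun a b => w (Equiv.swap i j a) (Equiv.swap i j b)) * w i j =
      pairProd n w * w j i := by
  have hone (a b : Fin n) : (w a b) = ∏ x, ∏ y, if x = a ∧ y = b then w a b else 1 := by
    rw [Finset.prod_eq_single a, Finset.prod_eq_single b]
    · simp
    · intro y _ hy; simp [hy]
    · simp
    · intro x _ hx; simp [hx]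
    · simp
  have hre : (pairProd n fun a b => w (Equiv.swap i j a) (Equiv.swap i j b)) =
      ∏ a, ∏ b, if Equiv.swap i j a < Equiv.swap i j b then w a b else 1 := by
    rw [pairProd, ← Equiv.prod_comp (Equiv.swap i j)]
    refine Finset.prod_congr rfl fun a _ => ?_
    rw [← Equiv.prod_comp (Equiv.swap i j)]
    simp
  rw [hre, hone i j, hone j i, pairProd, ← Finset.prod_mul_distrib, ← Finset.prod_mul_distrib]
  refine Finset.prod_congr rfl fun a _ => ?_
  rw [← Finset.prod_mul_distrib, ← Finset.prod_mul_distrib]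
  refine Finset.prod_congr rfl fun b _ => ?_
  have hne : i ≠ j := by rintro rfl; omega
  simp only [Equiv.swap_apply_def]
  rcases eq_or_ne a i with rfl | hai
  · rcases eq_or_ne b j with rfl | hbj
    · have : a < b := by rw [Fin.lt_def]; omega
      simp [hne, hne.symm, this, this.le]
    · rcases eq_or_ne b a with rfl | hba
      · simp [hne]
      · have : j < b ↔ a < b := by
          have := Fin.val_ne_of_ne hbj; have := Fin.val_ne_of_ne hba
          rw [Fin.lt_def, Fin.lt_def]; omega
        simp [hbj, hba, this, hne]
  · rcases eq_or_ne a j with rfl | haj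
    · rcases eq_or_ne b i with rfl | hbi
      · have : b < a := by rw [Fin.lt_def]; omega
        simp [hne, hne.symm, this, this.le]
      · rcases eq_or_ne b a with rfl | hba
        · simp [hai]
        · have : i < b ↔ a < b := by
            have := Fin.val_ne_of_ne hbi; have := Fin.val_ne_of_ne hba
            rw [Fin.lt_def, Fin.lt_def]; omega
          simp [hbi, hba, this, hai]
    · have h1 : a < j ↔ a < i := by
        have := Fin.val_ne_of_ne hai; have := Fin.val_ne_of_ne haj
        rw [Fin.lt_def, Fin.lt_def]; omega
      rcases eq_or_ne b i with rfl | hbi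
      · simp [hai, haj, h1]
      · rcases eq_or_ne b j with rfl | hbj
        · simp [hai, haj, h1, hbi]
        · simp [hai, haj, hbi, hbj]

theorem map_pairProd {N F : Type*} [CommMonoid N] [FunLike F M N] [MonoidHomClass F M N] (f : F)
    (n : ℕ) (w : Fin n → Fin n → M) : f (pairProd n w) = pairProd n fun i j => f (w i j) := by
  simp only [pairProd, map_prod]
  refine Finset.prod_congr rfl fun i _ => Finset.prod_congr rfl fun j _ => ?_
  split_ifs <;> simp

end pairProd

section coeffAt

variable {n : ℕ} (d : Fin n → ℕ)

open MvPolynomial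

theorem coeffAt_add (P Q : MvPolynomial (Fin n) ℚ) :
    coeffAt d (P + Q) = coeffAt d P + coeffAt d Q := coeff_add _ _ _

theorem coeffAt_sub (P Q : MvPolynomial (Fin n) ℚ) :
    coeffAt d (P - Q) = coeffAt d P - coeffAt d Q := coeff_sub _ _ _ _

theorem coeffAt_neg (P : MvPolynomial (Fin n) ℚ) :
    coeffAt d (-P) = -coeffAt d P := coeff_neg _ _ _

theorem coeffAt_sum {ι : Type*} (s : Finset ι) (P : ι → MvPolynomial (Fin n) ℚ) :
    coeffAt d (∑ i ∈ s, P i) = ∑ i ∈ s, coeffAt d (P i) := coeff_sum _ _ _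

theorem prod_X_pow_eq_monomial (s : Fin n → ℕ) :
    (∏ i, (X i : MvPolynomial (Fin n) ℚ) ^ s i) =
      monomial (Finsupp.equivFunOnFinite.symm s) 1 := by
  rw [monomial_eq, Finsupp.prod_fintype _ _ (by simp)]
  simp

theorem coeffAt_add_prod_X_pow (s : Fin n → ℕ) (P : MvPolynomial (Fin n) ℚ) :
    coeffAt (d + s) ((∏ i, X i ^ s i) * P) = coeffAt d P := by
  rw [prod_X_pow_eq_monomial, coeffAt, coeffAt]
  have : Finsupp.equivFunOnFinite.symm (d + s) =
      Finsupp.equivFunOnFinite.symm s + Finsupp.equivFunOnFinite.symm d := by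
    ext i; simp [add_comm]
  rw [this, coeff_monomial_mul, one_mul]

theorem coeffAt_X_pow_mul_eq_zero {r : Fin n} {e : ℕ} (h : d r < e)
    (P : MvPolynomial (Fin n) ℚ) : coeffAt d (X r ^ e * P) = 0 := by
  rw [coeffAt, X_pow_eq_monomial, coeff_monomial_mul', if_neg]
  intro hle
  have := hle r
  simp at this
  omega

theorem coeffAt_X_pow_mul {r : Fin n} {e : ℕ} (h : d r = e) (P : MvPolynomial (Fin n) ℚ) :
    coeffAt d (X r ^ e * P) = coeffAt (Function.update d r 0) P := by
  rw [coeffAt, X_pow_eq_monomial]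
  have : Finsupp.equivFunOnFinite.symm d =
      Finsupp.single r e + Finsupp.equivFunOnFinite.symm (Function.update d r 0) := by
    ext i
    rcases eq_or_ne i r with rfl | hi
    · simp [h]
    · simp [hi]
  rw [this, coeff_monomial_mul, one_mul, coeffAt]

theorem coeffAt_rename_equiv (σ : Equiv.Perm (Fin n)) (P : MvPolynomial (Fin n) ℚ) :
    coeffAt d (rename σ P) = coeffAt (d ∘ σ) P := by
  rw [coeffAt, coeffAt, ← coeff_rename_mapDomain σ σ.injective P]
  congr 1
  ext i
  obtain ⟨j, rfl⟩ := σ.surjective i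
  simp [Finsupp.mapDomain_apply σ.injective]

theorem coeffAt_eq_coeffAt_succAbove {k : ℕ} (d : Fin (k + 1) → ℕ) (r : Fin (k + 1)) (hr : d r = 0)
    (P : MvPolynomial (Fin (k + 1)) ℚ) :
    coeffAt d P = coeffAt (d ∘ r.succAbove)
      (aeval (r.insertNth 0 (fun i : Fin k => (X i : MvPolynomial (Fin k) ℚ))) P) := by
  induction P using MvPolynomial.induction_on' with
  | monomial u a =>
    rw [aeval_monomial, Finsupp.prod_fintype _ _ (by simp), Fin.prod_univ_succAbove _ r]
    simp only [Fin.insertNth_apply_same, Fin.insertNth_apply_succAbove]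
    rw [prod_X_pow_eq_monomial (fun i => u (r.succAbove i)), coeffAt, coeff_monomial]
    by_cases hu : u r = 0
    · rw [hu, pow_zero, one_mul, coeffAt, algebraMap_eq, C_mul_monomial, coeff_monomial, mul_one]
      congr 1
      rw [eq_iff_iff]
      constructor
      · rintro rfl; ext i; simp
      · intro h
        ext i
        rcases Fin.eq_self_or_eq_succAbove r i with rfl | ⟨j, rfl⟩
        · simp [hu, hr]
        · exact DFunLike.congr_fun h j
    · rw [zero_pow hu, zero_mul, mul_zero, if_neg]
      · simp [coeffAt]
      · rintro rfl; exact hu hr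
  | add p q hp hq => rw [coeffAt_add, map_add, coeffAt_add, hp, hq]

end coeffAt

section powerSum

open MvPolynomial

theorem pairProd_X_sub_X (n : ℕ) :
    (pairProd n fun i j => (X i - X j : MvPolynomial (Fin n) ℚ)) =
      ∑ σ : Equiv.Perm (Fin n), ((Equiv.Perm.sign σ : ℤ) : MvPolynomial (Fin n) ℚ) *
        ∏ i, (-X (σ i)) ^ (i : ℕ) := by
  have := Matrix.det_vandermonde (fun i : Fin n => (-X i : MvPolynomial (Fin n) ℚ))
  rw [Matrix.det_apply'] at this
  simp only [Matrix.vandermonde_apply] at this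
  rw [this, pairProd]
  refine Finset.prod_congr rfl fun i _ => ?_
  rw [← Finset.prod_filter]
  refine Finset.prod_congr (by ext; simp) fun j _ => by ring

/-- Up to monomials with some exponent larger than the number of variables, multiplying the
Vandermonde product by a power sum is the same as multiplying it by the product of the variables,
up to sign. -/
theorem coeffAt_powerSum_mul_vandermonde {k : ℕ} (d : Fin (k + 1) → ℕ) (hd : ∀ i, d i ≤ k + 1)
    (Q : MvPolynomial (Fin (k + 1)) ℚ) :
    coeffAt d ((∑ r, X r ^ (k + 1)) * ((pairProd (k + 1) fun i j => X i - X j) * Q)) =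
      (-1) ^ k * coeffAt d ((∏ r, X r) * ((pairProd (k + 1) fun i j => X i - X j) * Q)) := by
  have hsign (c : MvPolynomial (Fin (k + 1)) ℚ) :
      (-1) ^ k * coeffAt d c = coeffAt d ((-1) ^ k * c) := by
    rcases neg_one_pow_eq_or (MvPolynomial (Fin (k + 1)) ℚ) k with h | h <;>
    rcases Nat.even_or_odd k with h' | h' <;> simp [h'.neg_one_pow, coeffAt_neg]
  rw [hsign, pairProd_X_sub_X]
  rw [Finset.sum_mul Finset.univ (fun σ : Equiv.Perm (Fin (k + 1)) => _) Q]
  simp only [Finset.sum_mul, Finset.mul_sum, coeffAt_sum]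
  refine Fintype.sum_equiv (Equiv.mulRight (finRotate (k + 1))) _ _ fun σ => ?_
  rw [← Equiv.sum_comp σ (fun r => coeffAt d (X r ^ (k + 1) *
    (((Equiv.Perm.sign σ : ℤ) : MvPolynomial (Fin (k + 1)) ℚ) *
      (∏ i, (-X (σ i)) ^ (i : ℕ)) * Q))), Finset.sum_eq_single 0]
  · congr 1
    simp only [Equiv.coe_mulRight, Equiv.Perm.sign_mul, sign_finRotate, Equiv.Perm.mul_apply]
    rw [← Equiv.prod_comp ((finRotate (k + 1)).trans σ) X]
    simp only [Equiv.trans_apply]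
    rw [Fin.prod_univ_succ (fun i : Fin (k + 1) => (-X (σ i)) ^ (i : ℕ)),
      Fin.prod_univ_castSucc (fun i => X (σ (finRotate (k + 1) i))),
      Fin.prod_univ_castSucc (fun i => (-X (σ (finRotate (k + 1) i))) ^ (i : ℕ))]
    simp only [finRotate_apply, Fin.coeSucc_eq_succ, Fin.val_succ, Fin.val_last,
      Fin.val_castSucc, Fin.last_add_one, pow_succ (-X _ : MvPolynomial (Fin (k+1)) ℚ),
      Finset.prod_mul_distrib, Finset.prod_neg]
    have h1 : ((-1 : MvPolynomial (Fin (k + 1)) ℚ) ^ k) * (-1) ^ k = 1 := by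
      rw [← mul_pow]; simp
    simp only [Fin.val_zero, pow_zero, Finset.card_univ, Fintype.card_fin, Nat.add_sub_cancel]
    rw [neg_pow (X (σ 0) : MvPolynomial (Fin (k + 1)) ℚ) k]
    push_cast
    linear_combination (-X (σ 0) ^ (k + 1) * (-1) ^ k *
      ((Equiv.Perm.sign σ : ℤ) : MvPolynomial (Fin (k + 1)) ℚ) *
      (∏ i : Fin k, (-X (σ i.succ)) ^ (i : ℕ)) * (∏ i : Fin k, X (σ i.succ)) * Q) * h1
  · intro i _ hi
    rw [Finset.prod_eq_mul_prod_sdiff_singleton_of_mem (Finset.mem_univ i), neg_pow]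
    have : d (σ i) < k + 1 + i := by
      have := hd (σ i); have : (i : ℕ) ≠ 0 := fun h => hi (Fin.ext h); omega
    rw [← coeffAt_X_pow_mul_eq_zero d this ((-1) ^ (i : ℕ) *
      ((Equiv.Perm.sign σ : ℤ) : MvPolynomial (Fin (k + 1)) ℚ) *
      (∏ x ∈ Finset.univ \ {i}, (-X (σ x)) ^ (x : ℕ)) * Q)]
    congr 1
    ring
  · simp

end powerSum

section constTerm

open MvPolynomial

/-- The coefficient of `∏ X_i ^ d_i` in `∏ (1 + X_i) ^ c_i` times the product of all pair
factors, the `n` variables being numbered from `1`. -/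
noncomputable def pairCoeff (n : ℕ) (d c : ℕ → ℕ) : ℚ :=
  coeffAt (fun i : Fin n => d (i + 1)) ((∏ i : Fin n, (1 + X i) ^ c (i + 1)) * pairPoly n)

/-- Remove the `r`-th entry of a sequence. -/
def omitAt (r : ℕ) (d : ℕ → ℕ) (i : ℕ) : ℕ := if i < r then d i else d (i + 1)

/-- Remove the `r`-th entry of a sequence and increase the later ones by one. -/
def skipAt (r : ℕ) (c : ℕ → ℕ) (i : ℕ) : ℕ := if i < r then c i else c (i + 1) + 1

theorem omitAt_succAbove {k : ℕ} (r : Fin (k + 1)) (d : ℕ → ℕ) (i : Fin k) :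
    omitAt (r + 1) d (i + 1) = d (r.succAbove i + 1) := by
  simp only [omitAt, Fin.succAbove, Fin.lt_def]
  split_ifs <;> simp_all; omega

theorem aeval_insertNth_pairPoly {k : ℕ} (r : Fin (k + 1)) (c : ℕ → ℕ) :
    aeval (r.insertNth 0 (fun i : Fin k => (X i : MvPolynomial (Fin k) ℚ)))
      ((∏ i : Fin (k + 1), (1 + X i) ^ c (i + 1)) * pairPoly (k + 1)) =
    (-1) ^ (k - r : ℕ) * ((∏ i : Fin k, X i ^ 1) *
      ((∏ i : Fin k, (1 + X i) ^ skipAt (r + 1) c (i + 1)) * pairPoly k)) := by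
  rw [map_mul, pairPoly, map_pairProd, pairProd_succAbove _ _ r, map_prod,
    Fin.prod_univ_succAbove _ r]
  have hneg : (∏ i : Fin k, if (i : ℕ) < r then (1 : MvPolynomial (Fin k) ℚ) else -1) =
      (-1) ^ (k - r : ℕ) := by
    rw [Fin.prod_univ_eq_prod_range (fun i => if i < (r : ℕ) then (1 : MvPolynomial (Fin k) ℚ) else -1) k,
      Finset.prod_ite, Finset.prod_const_one, one_mul, Finset.prod_const]
    congr 1
    rw [show (Finset.range k).filter (fun i => ¬ i < (r : ℕ)) = Finset.Ico (r : ℕ) k by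
      ext i; simp; omega]
    simp
  rw [← hneg]
  simp only [map_pow, map_add, map_one, aeval_X, pairFactor, map_mul, map_sub,
    Fin.insertNth_apply_same, Fin.insertNth_apply_succAbove, pairPoly, add_zero, one_pow, one_mul]
  rw [← mul_assoc, ← mul_assoc, ← mul_assoc, ← Finset.prod_mul_distrib,
    ← Finset.prod_mul_distrib, ← Finset.prod_mul_distrib]
  congr 1
  refine Finset.prod_congr rfl fun i _ => ?_
  simp only [skipAt, Fin.succAbove, Fin.lt_def, Fin.val_castSucc, add_lt_add_iff_right]
  split_ifs
  · simp; ring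
  · simp; ring

theorem pairCoeff_succ (k : ℕ) (d c : ℕ → ℕ) (hd : ∀ i, 1 ≤ i → i ≤ k + 1 → d i ≤ k) :
    pairCoeff (k + 1) d c = ∑ r : Fin (k + 1), if d (r + 1) = k then
      (-1) ^ (r : ℕ) * pairCoeff k (omitAt (r + 1) d) (skipAt (r + 1) c) else 0 := by
  have hd' : ∀ i : Fin (k + 1), d (i + 1) + 1 ≤ k + 1 := fun i =>
    Nat.succ_le_succ (hd _ (by omega) (by omega))
  have hk : ((-1 : ℚ) ^ k) * (-1) ^ k = 1 := by rw [← mul_pow]; simp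
  set P := (∏ i : Fin (k + 1), ((1 + X i) ^ c (i + 1) : MvPolynomial (Fin (k + 1)) ℚ)) * pairPoly (k + 1)
    with hP
  have hfac : ∃ Q, P = (pairProd (k + 1) fun i j => X i - X j) * Q := by
    refine ⟨(∏ i : Fin (k + 1), (1 + X i) ^ c (i + 1)) *
      pairProd (k + 1) fun i j => 1 + X j + X i * X j, ?_⟩
    rw [hP, pairPoly]
    simp only [pairFactor]
    rw [pairProd_mul]
    ring
  obtain ⟨Q, hQ⟩ := hfac
  have h1 := coeffAt_powerSum_mul_vandermonde (fun i : Fin (k + 1) => d (i + 1) + 1) hd' Q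
  rw [← hQ] at h1
  have h2 : pairCoeff (k + 1) d c =
      coeffAt (fun i : Fin (k + 1) => d (i + 1) + 1) ((∏ r, X r) * P) := by
    have := coeffAt_add_prod_X_pow (fun i : Fin (k + 1) => d (i + 1)) (fun _ => 1) P
    simp only [pow_one] at this
    rw [pairCoeff, ← hP, ← this]
    rfl
  have h5 : pairCoeff (k + 1) d c = (-1) ^ k *
      coeffAt (fun i : Fin (k + 1) => d (i + 1) + 1) ((∑ r, X r ^ (k + 1)) * P) := by
    linear_combination h2 - (-1) ^ k * h1 -
      coeffAt (fun i : Fin (k + 1) => d (i + 1) + 1) ((∏ r, X r) * P) * hk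
  rw [h5, Finset.sum_mul, coeffAt_sum,
    Finset.mul_sum]
  refine Finset.sum_congr rfl fun r _ => ?_
  split_ifs with hr
  · rw [coeffAt_X_pow_mul _ (by simp [hr]), coeffAt_eq_coeffAt_succAbove _ r (by simp),
      hP, aeval_insertNth_pairPoly]
    have hd : (Function.update (fun i : Fin (k + 1) => d (i + 1) + 1) r 0 ∘ r.succAbove) =
        (fun i : Fin k => omitAt (r + 1) d (i + 1)) + fun _ => 1 := by
      ext i
      simp [omitAt_succAbove]
    have hs (e : ℕ) (d : Fin k → ℕ) (p : MvPolynomial (Fin k) ℚ) :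
        coeffAt d ((-1) ^ e * p) = (-1) ^ e * coeffAt d p := by
      rcases Nat.even_or_odd e with h' | h' <;> simp [h'.neg_one_pow, coeffAt_neg]
    rw [hd, hs, coeffAt_add_prod_X_pow, pairCoeff, ← mul_assoc]
    congr 1
    have h3 : (-1 : ℚ) ^ k = (-1) ^ (k - r : ℕ) * (-1) ^ (r : ℕ) := by
      rw [← pow_add]; congr 1; omega
    have h4 : (-1 : ℚ) ^ (k - r : ℕ) * (-1) ^ (k - r : ℕ) = 1 := by rw [← mul_pow]; simp
    linear_combination (-1) ^ (k - r : ℕ) * h3 + (-1) ^ (r : ℕ) * h4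
  · rw [coeffAt_X_pow_mul_eq_zero, mul_zero]
    have := hd' r
    omega

end constTerm

section twistedCoeff

open MvPolynomial

theorem rename_swap_pairPoly {n : ℕ} {i j : Fin n} (hij : (j : ℕ) = i + 1) :
    rename (Equiv.swap i j) ((1 + X i + X i * X j) * pairPoly n) =
      -((1 + X i + X i * X j) * pairPoly n) := by
  have h := pairProd_adjacent_swap n
    (fun a b => pairFactor (X a : MvPolynomial (Fin n) ℚ) (X b)) hij
  have hne : i ≠ j := by rintro rfl; omega
  have hr : rename (Equiv.swap i j) (pairPoly n) = pairProd n fun a b =>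
      pairFactor (X (Equiv.swap i j a) : MvPolynomial (Fin n) ℚ) (X (Equiv.swap i j b)) := by
    rw [pairPoly, map_pairProd]
    simp [pairFactor]
  have h0 : pairPoly n = pairProd n fun a b => pairFactor (X a) (X b) := rfl
  rw [← hr, ← h0] at h
  have hx : (X i - X j : MvPolynomial (Fin n) ℚ) ≠ 0 :=
    sub_ne_zero.2 fun h => hne (X_injective h)
  apply mul_left_cancel₀ hx
  simp only [map_mul, map_add, map_one, rename_X, Equiv.swap_apply_left, Equiv.swap_apply_right]
  simp only [pairFactor] at h
  linear_combination h

theorem coeffAt_symmetric_mul_pairPoly {n : ℕ} {i j : Fin n} (hij : (j : ℕ) = i + 1)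
    {d : Fin n → ℕ} (hd : d i = d j) {S : MvPolynomial (Fin n) ℚ}
    (hS : rename (Equiv.swap i j) S = S) :
    coeffAt d (S * ((1 + X i + X i * X j) * pairPoly n)) = 0 := by
  have hd' : d ∘ Equiv.swap i j = d := by
    ext a
    simp only [Function.comp, Equiv.swap_apply_def]
    split_ifs <;> simp_all
  have h := coeffAt_rename_equiv d (Equiv.swap i j) (S * ((1 + X i + X i * X j) * pairPoly n))
  rw [map_mul, hS, rename_swap_pairPoly hij, hd', mul_neg, coeffAt_neg] at h
  linarith

/-- The coefficient of `∏ X_i ^ d_i` in `∏ X_i ^ s_i (1 + X_i) ^ c_i` times the product of all pair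
factors, the `n` variables being numbered from `1`. -/
noncomputable def twistedCoeff (n : ℕ) (d s c : ℕ → ℕ) : ℚ :=
  coeffAt (fun i : Fin n => d (i + 1))
    ((∏ i : Fin n, X i ^ s (i + 1) * (1 + X i) ^ c (i + 1)) * pairPoly n)

theorem twistedCoeff_add (n : ℕ) (d s c : ℕ → ℕ) :
    twistedCoeff n (d + s) s c = pairCoeff n d c := by
  rw [twistedCoeff, Finset.prod_mul_distrib, mul_assoc, pairCoeff]
  exact coeffAt_add_prod_X_pow (fun i : Fin n => d (i + 1)) (fun i : Fin n => s (i + 1)) _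

theorem twistedCoeff_zero (n : ℕ) (d c : ℕ → ℕ) : twistedCoeff n d 0 c = pairCoeff n d c :=
  twistedCoeff_add n d 0 c

theorem twistedCoeff_congr {n : ℕ} {d d' s s' c c' : ℕ → ℕ}
    (hd : ∀ i, 1 ≤ i → i ≤ n → d i = d' i) (hs : ∀ i, 1 ≤ i → i ≤ n → s i = s' i)
    (hc : ∀ i, 1 ≤ i → i ≤ n → c i = c' i) : twistedCoeff n d s c = twistedCoeff n d' s' c' := by
  have h1 (i : Fin n) : d (i + 1) = d' (i + 1) := hd _ (by omega) (by omega)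
  have h2 (i : Fin n) : s (i + 1) = s' (i + 1) := hs _ (by omega) (by omega)
  have h3 (i : Fin n) : c (i + 1) = c' (i + 1) := hc _ (by omega) (by omega)
  simp only [twistedCoeff, h1, h2, h3]

theorem twistedCoeff_telescope {n : ℕ} (d s c : ℕ → ℕ) {i : ℕ} (h1 : 1 ≤ i) (hn : i ≤ n) :
    twistedCoeff n d (Function.update s i 1) c =
      twistedCoeff n d (Function.update s i 0) (Function.update c i (c i + 1)) -
        twistedCoeff n d (Function.update s i 0) c := by
  obtain ⟨a, rfl⟩ : ∃ a : Fin n, i = a + 1 := ⟨⟨i - 1, by omega⟩, by simp; omega⟩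
  simp only [twistedCoeff]
  rw [← coeffAt_sub, ← sub_mul]
  congr 2
  simp only [← Finset.mul_prod_erase Finset.univ _ (Finset.mem_univ a)]
  have h (s' c' : ℕ → ℕ) (hs : ∀ x, x ≠ (a : ℕ) + 1 → s' x = s x)
      (hc : ∀ x, x ≠ (a : ℕ) + 1 → c' x = c x) : (∏ x ∈ Finset.univ.erase a,
        ((X x : MvPolynomial (Fin n) ℚ) ^ s' (x + 1) * (1 + X x) ^ c' (x + 1))) =
      ∏ x ∈ Finset.univ.erase a, (X x ^ s (x + 1) * (1 + X x) ^ c (x + 1)) := by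
    refine Finset.prod_congr rfl fun x hx => ?_
    have : (x : ℕ) + 1 ≠ a + 1 := by
      have := Fin.val_ne_of_ne (Finset.ne_of_mem_erase hx); omega
    rw [hs _ this, hc _ this]
  rw [h (Function.update s (a + 1 : ℕ) 1) c (fun x hx => by simp [hx]) fun _ _ => rfl,
    h (Function.update s (a + 1 : ℕ) 0) c (fun x hx => by simp [hx]) fun _ _ => rfl,
    h (Function.update s (a + 1 : ℕ) 0) (Function.update c (a + 1 : ℕ) (c (a + 1) + 1))
      (fun x hx => by simp [hx]) fun x hx => by simp [hx]]
  simp only [Function.update_self, pow_zero, pow_succ]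
  ring

theorem twistedCoeff_merge {n : ℕ} (d s c : ℕ → ℕ) {i : ℕ} (h1 : 1 ≤ i) (hn : i + 1 ≤ n)
    (hd : d i = d (i + 1)) (v : ℕ) :
    twistedCoeff n d (Function.update (Function.update s i 1) (i + 1) 1)
        (Function.update (Function.update c i v) (i + 1) v) =
      -twistedCoeff n d (Function.update (Function.update s i 0) (i + 1) 0)
        (Function.update (Function.update c i (v + 1)) (i + 1) v) := by
  obtain ⟨a, rfl⟩ : ∃ a : Fin n, i = a + 1 := ⟨⟨i - 1, by omega⟩, by simp; omega⟩
  obtain ⟨b, hb⟩ : ∃ b : Fin n, (b : ℕ) = a + 1 := ⟨⟨a + 1, by omega⟩, rfl⟩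
  rw [eq_neg_iff_add_eq_zero]
  simp only [twistedCoeff]
  rw [← coeffAt_add, ← add_mul]
  have hne : a ≠ b := by rintro rfl; omega
  have hba : b ∈ Finset.univ.erase a := by simp [hne.symm]
  simp only [← Finset.mul_prod_erase Finset.univ _ (Finset.mem_univ a),
    ← Finset.mul_prod_erase _ _ hba]
  have h (s' c' : ℕ → ℕ) (u v w z : ℕ) : (∏ x ∈ (Finset.univ.erase a).erase b,
      ((X x : MvPolynomial (Fin n) ℚ) ^
          Function.update (Function.update s' (a + 1 : ℕ) u) (a + 1 + 1 : ℕ) w (x + 1) *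
        (1 + X x) ^
          Function.update (Function.update c' (a + 1 : ℕ) v) (a + 1 + 1 : ℕ) z (x + 1))) =
      ∏ x ∈ (Finset.univ.erase a).erase b, (X x ^ s' (x + 1) * (1 + X x) ^ c' (x + 1)) := by
    refine Finset.prod_congr rfl fun x hx => ?_
    simp only [Finset.mem_erase, Finset.mem_univ, and_true] at hx
    have h1 : (x : ℕ) + 1 ≠ a + 1 := by have := Fin.val_ne_of_ne hx.2; omega
    have h2 : (x : ℕ) + 1 ≠ a + 1 + 1 := by have := Fin.val_ne_of_ne hx.1; omega
    rw [Function.update_of_ne h2, Function.update_of_ne h1, Function.update_of_ne h2,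
      Function.update_of_ne h1]
  rw [h, h]
  set M := ∏ x ∈ (Finset.univ.erase a).erase b,
    ((X x : MvPolynomial (Fin n) ℚ) ^ s (x + 1) * (1 + X x) ^ c (x + 1)) with hM
  have hS : rename (Equiv.swap a b) ((1 + X a) ^ v * (1 + X b) ^ v * M) =
      (1 + X a) ^ v * (1 + X b) ^ v * M := by
    have hM' : rename (Equiv.swap a b) M = M := by
      rw [hM, map_prod]
      refine Finset.prod_congr rfl fun x hx => ?_
      simp only [Finset.mem_erase, Finset.mem_univ, and_true] at hx
      simp [Equiv.swap_apply_of_ne_of_ne hx.2 hx.1]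
    simp only [map_mul, hM', map_pow, map_add, map_one, rename_X, Equiv.swap_apply_left,
      Equiv.swap_apply_right]
    ring
  have := coeffAt_symmetric_mul_pairPoly (i := a) (j := b) hb
    (d := fun i : Fin n => d (i + 1)) (by simpa [hb] using hd) hS
  rw [← this]
  congr 1
  have hlt : (a : ℕ) + 1 ≠ a + 1 + 1 := by omega
  simp only [hb, Function.update_self, Function.update_of_ne hlt, pow_zero, pow_succ]
  ring

end twistedCoeff

/-- `c` on the `k` positions starting at `p`, and `e` elsewhere. -/
def splice (p k : ℕ) (c e : ℕ → ℕ) (i : ℕ) : ℕ := if p ≤ i ∧ i < p + k then c i else e i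

/-- The sequences on `p, …, p + k - 1` that interlace with `b` and are strictly increasing,
extended by zero. -/
noncomputable def interlacing (p : ℕ) (b : ℕ → ℕ) : ℕ → Finset (ℕ → ℕ)
  | 0 => {0}
  | k + 1 => by
    classical
    exact ((interlacing p b k ×ˢ Finset.Icc (b (p + k)) (b (p + k + 1))).filter
      fun x => 0 < k → x.1 (p + k - 1) < x.2).image fun x => Function.update x.1 (p + k) x.2

theorem mem_interlacing (p : ℕ) (b : ℕ → ℕ) (k : ℕ) (c : ℕ → ℕ) :
    c ∈ interlacing p b k ↔
      (∀ i, p ≤ i → i < p + k → b i ≤ c i ∧ c i ≤ b (i + 1)) ∧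
        (∀ i, p ≤ i → i + 1 < p + k → c i < c (i + 1)) ∧
          ∀ i, ¬ (p ≤ i ∧ i < p + k) → c i = 0 := by
  induction k generalizing c with
  | zero =>
    simp only [interlacing, Finset.mem_singleton]
    constructor
    · rintro rfl
      exact ⟨fun i _ _ => by omega, fun i _ _ => by omega, fun i _ => rfl⟩
    · rintro ⟨-, -, h⟩
      funext i
      exact h i (by omega)
  | succ k ih =>
    simp only [interlacing, Finset.mem_image, Finset.mem_filter, Finset.mem_product, ih,
      Finset.mem_Icc, Prod.exists]
    constructor
    · rintro ⟨c', v, ⟨⟨⟨h1, h2, h3⟩, h4⟩, h5⟩, rfl⟩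
      refine ⟨fun i hi hi' => ?_, fun i hi hi' => ?_, fun i hi => ?_⟩
      · rcases eq_or_ne i (p + k) with rfl | hne
        · simpa using h4
        · rw [Function.update_of_ne hne]
          exact h1 i hi (by omega)
      · rw [Function.update_of_ne (by omega)]
        rcases eq_or_ne (i + 1) (p + k) with h | hne
        · rw [h, Function.update_self, show i = p + k - 1 by omega]
          exact h5 (by omega)
        · rw [Function.update_of_ne hne]
          exact h2 i hi (by omega)
      · rw [Function.update_of_ne (by omega)]
        exact h3 i (by omega)
    · rintro ⟨h1, h2, h3⟩
      refine ⟨Function.update c (p + k) 0, c (p + k), ⟨⟨⟨fun i hi hi' => ?_, fun i hi hi' => ?_,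
        fun i hi => ?_⟩, h1 _ (by omega) (by omega)⟩, fun hk => ?_⟩, by simp⟩
      · rw [Function.update_of_ne (by omega)]
        exact h1 i hi (by omega)
      · rw [Function.update_of_ne (by omega), Function.update_of_ne (by omega)]
        exact h2 i hi (by omega)
      · rcases eq_or_ne i (p + k) with rfl | hne
        · simp
        · rw [Function.update_of_ne hne]
          exact h3 i (by omega)
      · rw [Function.update_of_ne (by omega)]
        have := h2 (p + k - 1) (by omega) (by omega)
        rwa [show p + k - 1 + 1 = p + k by omega] at this

theorem sum_interlacing_succ (p : ℕ) (b : ℕ → ℕ) (k : ℕ) (f : (ℕ → ℕ) → ℚ) :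
    ∑ c ∈ interlacing p b (k + 1), f c =
      ∑ x ∈ (interlacing p b k ×ˢ Finset.Icc (b (p + k)) (b (p + k + 1))).filter
        (fun x => 0 < k → x.1 (p + k - 1) < x.2), f (Function.update x.1 (p + k) x.2) := by
  classical
  rw [interlacing, Finset.sum_image]
  rintro ⟨c, v⟩ hc ⟨c', v'⟩ hc' h
  simp only [Finset.coe_filter, Finset.mem_product, mem_interlacing, Set.mem_ofPred_eq] at hc hc'
  dsimp only at h
  have hv : v = v' := by simpa using congrFun h (p + k)
  have hcc : c = c' := by
    funext i
    rcases eq_or_ne i (p + k) with rfl | hne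
    · rw [hc.1.1.2.2 _ (by omega), hc'.1.1.2.2 _ (by omega)]
    · simpa [hne] using congrFun h i
  rw [hv, hcc]

theorem sum_interlacing_one (p : ℕ) (b : ℕ → ℕ) (f : (ℕ → ℕ) → ℚ) :
    ∑ c ∈ interlacing p b 1, f c =
      ∑ v ∈ Finset.Icc (b p) (b (p + 1)), f (Function.update 0 p v) := by
  rw [sum_interlacing_succ, Finset.filter_true_of_mem (by simp), Finset.sum_product]
  simp [interlacing]

theorem sum_interlacing_add_two (p : ℕ) (b : ℕ → ℕ) (k : ℕ)
    (hb : ∀ i, p ≤ i → i ≤ p + k + 1 → b i < b (i + 1)) (f : (ℕ → ℕ) → ℚ) :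
    ∑ c ∈ interlacing p b (k + 2), f c =
      ∑ c ∈ interlacing p b (k + 1), ∑ v ∈ Finset.Icc (b (p + k + 1)) (b (p + k + 2)),
        f (Function.update c (p + k + 1) v) -
      ∑ c ∈ interlacing p b k,
        f (Function.update (Function.update c (p + k) (b (p + k + 1))) (p + k + 1)
          (b (p + k + 1))) := by
  rw [sum_interlacing_succ p b (k + 1), ← Finset.sum_product', eq_sub_iff_add_eq,
    ← Finset.sum_filter_add_sum_filter_not (interlacing p b (k + 1) ×ˢ _)
      (fun x => 0 < k + 1 → x.1 (p + (k + 1) - 1) < x.2)]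
  congr 1
  symm
  refine Finset.sum_bij' (fun x _ => Function.update x.1 (p + k) 0)
    (fun c _ => (Function.update c (p + k) (b (p + k + 1)), b (p + k + 1))) ?_ ?_ ?_ ?_ ?_
  · rintro ⟨c, v⟩ hc
    simp only [Finset.mem_filter, Finset.mem_product, mem_interlacing, Finset.mem_Icc] at hc ⊢
    obtain ⟨⟨⟨h1, h2, h3⟩, -⟩, -⟩ := hc
    refine ⟨fun i hi hi' => ?_, fun i hi hi' => ?_, fun i hi => ?_⟩
    · rw [Function.update_of_ne (by omega)]
      exact h1 i hi (by omega)
    · rw [Function.update_of_ne (by omega), Function.update_of_ne (by omega)]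
      exact h2 i hi (by omega)
    · rcases eq_or_ne i (p + k) with rfl | hne
      · simp
      · rw [Function.update_of_ne hne]
        exact h3 i (by omega)
  · intro c hc
    simp only [Finset.mem_filter, Finset.mem_product, mem_interlacing, Finset.mem_Icc] at hc ⊢
    obtain ⟨h1, h2, h3⟩ := hc
    refine ⟨⟨⟨fun i hi hi' => ?_, fun i hi hi' => ?_, fun i hi => ?_⟩, le_rfl, ?_⟩, ?_⟩
    · rcases eq_or_ne i (p + k) with rfl | hne
      · simpa using (hb (p + k) (by omega) (by omega)).le
      · rw [Function.update_of_ne hne]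
        exact h1 i hi (by omega)
    · rw [Function.update_of_ne (by omega)]
      rcases eq_or_ne (i + 1) (p + k) with h | hne
      · rw [h, Function.update_self]
        have := (h1 i hi (by omega)).2
        have := hb (p + k) (by omega) (by omega)
        rw [h] at *
        omega
      · rw [Function.update_of_ne hne]
        exact h2 i hi (by omega)
    · rw [Function.update_of_ne (by omega)]
      exact h3 i (by omega)
    · exact (hb (p + k + 1) (by omega) le_rfl).le
    · simp
  · rintro ⟨c, v⟩ hc
    simp only [Finset.mem_filter, Finset.mem_product, mem_interlacing, Finset.mem_Icc] at hc
    obtain ⟨⟨⟨h1, -, -⟩, h4, -⟩, h5⟩ := hc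
    have h6 := (h1 (p + k) (by omega) (by omega)).2
    simp only [Nat.zero_lt_succ, forall_const, not_lt, Nat.add_succ_sub_one, ← add_assoc] at h5 h6
    have h7 : c (p + k) = b (p + k + 1) := le_antisymm h6 (h4.trans h5)
    have h8 : v = b (p + k + 1) := le_antisymm (h5.trans h6) h4
    simp [← h7, h8]
  · intro c hc
    rw [mem_interlacing] at hc
    have := hc.2.2 (p + k) (by omega)
    simp [← this]
  · rintro ⟨c, v⟩ hc
    simp only [Finset.mem_filter, Finset.mem_product, mem_interlacing, Finset.mem_Icc] at hc
    obtain ⟨⟨⟨h1, -, -⟩, h4, -⟩, h5⟩ := hc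
    have h6 := (h1 (p + k) (by omega) (by omega)).2
    simp only [Nat.zero_lt_succ, forall_const, not_lt, Nat.add_succ_sub_one, ← add_assoc] at h5 h6
    have h7 : c (p + k) = b (p + k + 1) := le_antisymm h6 (h4.trans h5)
    have h8 : v = b (p + k + 1) := le_antisymm (h5.trans h6) h4
    simp [← h7, h8]

theorem sum_Icc_telescope (Φ : (ℕ → ℕ) → (ℕ → ℕ) → ℚ) (i : ℕ)
    (h : ∀ s c, Φ (Function.update s i 1) c = Φ (Function.update s i 0) (Function.update c i (c i + 1)) -
      Φ (Function.update s i 0) c) (s c : ℕ → ℕ) {x y : ℕ} (hxy : x ≤ y) :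
    ∑ v ∈ Finset.Icc x y, Φ (Function.update s i 1) (Function.update c i v) =
      Φ (Function.update s i 0) (Function.update c i (y + 1)) -
        Φ (Function.update s i 0) (Function.update c i x) := by
  induction y, hxy using Nat.le_induction with
  | base => simp [h]
  | succ y hy ih =>
    rw [Finset.sum_Icc_succ_top (by omega), ih, h]
    simp

/-- The summation formula over interlacing sequences, for functions of the form
an iterated difference (recorded by the first argument) obeying the merging rule for adjacent
entries. -/
theorem sum_interlacing_eq_alternating_sum (Φ : (ℕ → ℕ) → (ℕ → ℕ) → ℚ) (p K : ℕ) (b : ℕ → ℕ)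
    (hb : ∀ i, p ≤ i → i < p + K → b i < b (i + 1))
    (htel : ∀ i, p ≤ i → i < p + K → ∀ s c, Φ (Function.update s i 1) c =
      Φ (Function.update s i 0) (Function.update c i (c i + 1)) - Φ (Function.update s i 0) c)
    (hmerge : ∀ i, p ≤ i → i + 1 < p + K → ∀ s c v,
      Φ (Function.update (Function.update s i 1) (i + 1) 1)
          (Function.update (Function.update c i v) (i + 1) v) =
        -Φ (Function.update (Function.update s i 0) (i + 1) 0)
          (Function.update (Function.update c i (v + 1)) (i + 1) v))
    (k : ℕ) (hk : k ≤ K) (s e : ℕ → ℕ) :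
    ∑ c ∈ interlacing p b k, Φ (splice p k 1 s) (splice p k c e) =
      ∑ r ∈ Finset.range (k + 1),
        (-1) ^ r * Φ (splice p k 0 s) (splice p k (skipAt (p + r) b) e) := by
  induction k using Nat.twoStepInduction generalizing s e with
  | zero =>
    have h (c e : ℕ → ℕ) : splice p 0 c e = e := by funext i; grind [splice]
    simp [interlacing, h]
  | one =>
    have h (c e : ℕ → ℕ) : splice p 1 c e = Function.update e p (c p) := by
      funext i; grind [splice, Function.update_apply]
    rw [sum_interlacing_one]
    simp only [h, Function.update_self, Pi.one_apply, Pi.zero_apply, Finset.sum_range_succ,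
      Finset.sum_range_zero]
    rw [sum_Icc_telescope Φ p (htel p le_rfl (by omega)) _ _ (hb p le_rfl (by omega)).le]
    simp [skipAt]
    ring
  | more k ih1 ih2 =>
    rw [sum_interlacing_add_two p b k fun i hi hi' => hb i hi (by omega)]
    have e1 (c : ℕ → ℕ) (v : ℕ) : splice p (k + 2) (Function.update c (p + k + 1) v) e =
        Function.update (splice p (k + 1) c e) (p + k + 1) v := by
      funext i; grind [splice, Function.update_apply]
    have e2 (c e : ℕ → ℕ) (v : ℕ) : Function.update (splice p (k + 1) c e) (p + k + 1) v =
        splice p (k + 1) c (Function.update e (p + k + 1) v) := by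
      funext i; grind [splice, Function.update_apply]
    have e3 : splice p (k + 2) 1 s = Function.update (splice p (k + 1) 1 s) (p + k + 1) 1 := by
      funext i
      simp only [splice, Function.update_apply, Pi.one_apply]
      grind
    have e4 : splice p (k + 1) 0 (Function.update s (p + k + 1) 0) = splice p (k + 2) 0 s := by
      funext i
      simp only [splice, Function.update_apply, Pi.zero_apply]
      grind
    have f1 (c : ℕ → ℕ) (u v : ℕ) :
        splice p (k + 2) (Function.update (Function.update c (p + k) u) (p + k + 1) v) e =
        Function.update (Function.update (splice p k c e) (p + k) u) (p + k + 1) v := by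
      funext i; grind [splice, Function.update_apply]
    have f2 (c e : ℕ → ℕ) (u v : ℕ) :
        Function.update (Function.update (splice p k c e) (p + k) u) (p + k + 1) v =
        splice p k c (Function.update (Function.update e (p + k) u) (p + k + 1) v) := by
      funext i; grind [splice, Function.update_apply]
    have f3 : splice p (k + 2) 1 s =
        Function.update (Function.update (splice p k 1 s) (p + k) 1) (p + k + 1) 1 := by
      funext i
      simp only [splice, Function.update_apply, Pi.one_apply]
      grind
    have f4 : splice p k 0 (Function.update (Function.update s (p + k) 0) (p + k + 1) 0) =
        splice p (k + 2) 0 s := by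
      funext i
      simp only [splice, Function.update_apply, Pi.zero_apply]
      grind
    have g1 (r : ℕ) (hr : r ∈ Finset.range (k + 2)) : splice p (k + 1) (skipAt (p + r) b)
        (Function.update e (p + k + 1) (b (p + k + 2) + 1)) =
        splice p (k + 2) (skipAt (p + r) b) e := by
      rw [Finset.mem_range] at hr
      funext i
      simp only [splice, Function.update_apply, skipAt]
      grind
    have g2 : splice p (k + 1) (skipAt (p + (k + 1)) b)
        (Function.update e (p + k + 1) (b (p + k + 1))) =
        splice p (k + 2) (skipAt (p + (k + 2)) b) e := by
      funext i
      simp only [splice, Function.update_apply, skipAt]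
      grind
    have g3 (r : ℕ) (hr : r ∈ Finset.range (k + 1)) : splice p (k + 1) (skipAt (p + r) b)
        (Function.update e (p + k + 1) (b (p + k + 1))) =
        splice p k (skipAt (p + r) b) (Function.update
          (Function.update e (p + k) (b (p + k + 1) + 1)) (p + k + 1) (b (p + k + 1))) := by
      rw [Finset.mem_range] at hr
      funext i
      simp only [splice, Function.update_apply, skipAt]
      grind
    have h1 : ∑ c ∈ interlacing p b (k + 1), ∑ v ∈ Finset.Icc (b (p + k + 1)) (b (p + k + 2)),
        Φ (splice p (k + 2) 1 s) (splice p (k + 2) (Function.update c (p + k + 1) v) e) =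
        ∑ r ∈ Finset.range (k + 2),
          (-1) ^ r * Φ (splice p (k + 2) 0 s) (splice p (k + 2) (skipAt (p + r) b) e) -
        ∑ r ∈ Finset.range (k + 2), (-1) ^ r * Φ (splice p (k + 2) 0 s)
          (splice p (k + 1) (skipAt (p + r) b)
            (Function.update e (p + k + 1) (b (p + k + 1)))) := by
      simp only [e1, e3]
      simp only [sum_Icc_telescope Φ (p + k + 1) (htel _ (by omega) (by omega)) _ _
        (hb (p + k + 1) (by omega) (by omega)).le, Finset.sum_sub_distrib]
      simp only [e2]
      rw [ih2 (by omega), ih2 (by omega), e4]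
      congr 1
      exact Finset.sum_congr rfl fun r hr => by rw [g1 r hr]
    have h2 : ∑ c ∈ interlacing p b k, Φ (splice p (k + 2) 1 s)
          (splice p (k + 2) (Function.update (Function.update c (p + k) (b (p + k + 1)))
            (p + k + 1) (b (p + k + 1))) e) =
        -∑ r ∈ Finset.range (k + 1), (-1) ^ r * Φ (splice p (k + 2) 0 s)
          (splice p (k + 1) (skipAt (p + r) b)
            (Function.update e (p + k + 1) (b (p + k + 1)))) := by
      simp only [f1, f3]
      simp only [hmerge (p + k) (by omega) (by omega), Finset.sum_neg_distrib]
      simp only [f2]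
      rw [ih1 (by omega), f4]
      congr 1
      exact Finset.sum_congr rfl fun r hr => by rw [g3 r hr]
    have h3 : ∑ r ∈ Finset.range (k + 2), (-1) ^ r * Φ (splice p (k + 2) 0 s)
          (splice p (k + 1) (skipAt (p + r) b)
            (Function.update e (p + k + 1) (b (p + k + 1)))) =
        ∑ r ∈ Finset.range (k + 1), (-1) ^ r * Φ (splice p (k + 2) 0 s)
          (splice p (k + 1) (skipAt (p + r) b)
            (Function.update e (p + k + 1) (b (p + k + 1)))) +
        (-1) ^ (k + 1) * Φ (splice p (k + 2) 0 s)
          (splice p (k + 2) (skipAt (p + (k + 2)) b) e) := by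
      rw [Finset.sum_range_succ, g2]
    rw [h1, h2, h3, Finset.sum_range_succ _ (k + 2)]
    ring
theorem pairCoeff_congr {n : ℕ} {d d' c c' : ℕ → ℕ} (hd : ∀ i, 1 ≤ i → i ≤ n → d i = d' i)
    (hc : ∀ i, 1 ≤ i → i ≤ n → c i = c' i) : pairCoeff n d c = pairCoeff n d' c' := by
  rw [← twistedCoeff_zero, ← twistedCoeff_zero]
  exact twistedCoeff_congr hd (fun _ _ _ => rfl) hc

/-- Adding one variable amounts to summing over interlacing exponents. -/
theorem pairCoeff_succ_eq_sum_interlacing {k p K : ℕ} {d d' b : ℕ → ℕ} (hp : 1 ≤ p)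
    (hpK : p + K ≤ k + 1) (hb : ∀ i, p ≤ i → i < p + K → b i < b (i + 1))
    (hd : ∀ i, p ≤ i → i ≤ p + K → d i = k)
    (hdlt : ∀ i, 1 ≤ i → i ≤ k + 1 → ¬ (p ≤ i ∧ i ≤ p + K) → d i < k)
    (hd'_lt : ∀ i, 1 ≤ i → i < p → d' i = d i)
    (hd'_mid : ∀ i, p ≤ i → i < p + K → d' i + 1 = k)
    (hd'_ge : ∀ i, p + K ≤ i → i ≤ k → d' i = d (i + 1)) :
    pairCoeff (k + 1) d b = (-1) ^ (p - 1) *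
      ∑ c ∈ interlacing p b K, pairCoeff k d' (splice p K c (skipAt p b)) := by
  have hle : ∀ i, 1 ≤ i → i ≤ k + 1 → d i ≤ k := by
    intro i h1 h2
    by_cases h : p ≤ i ∧ i ≤ p + K
    · exact (hd i h.1 h.2).le
    · exact (hdlt i h1 h2 h).le
  have hsum := sum_interlacing_eq_alternating_sum (twistedCoeff k (d' + splice p K 1 0)) p K b hb
    (fun i h1 h2 s c => twistedCoeff_telescope _ s c (by omega) (by omega))
    (fun i h1 h2 s c v => twistedCoeff_merge _ s c (by omega) (by omega) (by
      have := hd'_mid i h1 (by omega)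
      have := hd'_mid (i + 1) (by omega) h2
      have h3 : splice p K 1 0 i = 1 := if_pos ⟨h1, by omega⟩
      have h4 : splice p K 1 0 (i + 1) = 1 := if_pos ⟨by omega, h2⟩
      simp only [Pi.add_apply, h3, h4]
      omega) v) K le_rfl 0 (skipAt p b)
  have hzero : splice p K 0 0 = 0 := by funext i; simp [splice]
  simp only [twistedCoeff_add, hzero, twistedCoeff_zero] at hsum
  rw [hsum, pairCoeff_succ k d b hle, Fin.sum_univ_eq_sum_range (fun r => if d (r + 1) = k then
      (-1) ^ r * pairCoeff k (omitAt (r + 1) d) (skipAt (r + 1) b) else 0) (k + 1), Finset.mul_sum]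
  have hsub : Finset.Ico (p - 1) (p + K) ⊆ Finset.range (k + 1) := by
    intro i; simp; omega
  rw [← Finset.sum_subset hsub, Finset.sum_Ico_eq_sum_range,
    show p + K - (p - 1) = K + 1 by omega]
  · refine Finset.sum_congr rfl fun r hr => ?_
    rw [Finset.mem_range] at hr
    rw [show p - 1 + r + 1 = p + r by omega, if_pos (hd _ (by omega) (by omega)), pow_add,
      mul_assoc]
    congr 2
    refine pairCoeff_congr (fun i h1 h2 => ?_) fun i h1 h2 => ?_
    · simp only [omitAt, Pi.add_apply, splice, Pi.one_apply, Pi.zero_apply]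
      rcases lt_or_ge i p with h | h
      · rw [if_pos (by omega), if_neg (by omega), hd'_lt i h1 h, add_zero]
      · rcases lt_or_ge i (p + K) with h' | h'
        · rw [if_pos (⟨h, h'⟩ : _ ∧ _), hd'_mid i h h']
          split_ifs
          · exact hd i h h'.le
          · exact hd (i + 1) (by omega) (by omega)
        · rw [if_neg (by omega), if_neg (by omega), hd'_ge i h' h2, add_zero]
    · simp only [splice, skipAt]
      split_ifs <;> first | rfl | omega
  · intro i hi hi'
    rw [Finset.mem_range] at hi
    rw [Finset.mem_Ico] at hi'
    rw [if_neg]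
    exact (hdlt (i + 1) (by omega) (by omega) (by omega)).ne

/-- The exponents of the variables at which the coefficient is extracted. -/
def pentCap (n kL kR i : ℕ) : ℕ :=
  if i ≤ n - kR then kR + i - 1 else if i ≤ kL then n - 1 else n + kL - i

/-- The exponents of the factors `1 + x_i`: a row of a pentagon, completed by the bounds of the
cut off diagonals. -/
def pentExp (m n kL kR : ℕ) (b : ℕ → ℕ) (i : ℕ) : ℕ :=
  if i ≤ n - kR then i else if i ≤ kL then b i else m + kL + 1

section pentagons

variable {m k kL kR kL' kR' p K : ℕ} {b : ℕ → ℕ}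

theorem pentExp_lt_succ (hL : kL' = min kL (k + 1)) (hR : kR' = min kR (k + 1))
    (hkL : kL ≤ k + 2) (hkR : kR ≤ k + 2) (hk : k + 3 ≤ kL + kR)
    (hp : p = k + 1 - kR' + 1) (hK : p + K = kL' + 1)
    (hbs : ∀ j, k + 2 - kR + 1 ≤ j → j < kL → b j < b (j + 1))
    (hbd : ∀ j, k + 2 - kR + 1 ≤ j → j ≤ kL → j ≤ b j ∧ b j ≤ m + j)
    (i : ℕ) (hi : i < p + K) :
    pentExp m (k + 2) kL kR b i < pentExp m (k + 2) kL kR b (i + 1) := by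
  have h3 := hbs i
  have h4 := hbd i
  have h5 := hbd (i + 1)
  simp only [pentExp]
  split_ifs <;> omega

theorem pairCoeff_pentExp (hL : kL' = min kL (k + 1)) (hR : kR' = min kR (k + 1))
    (hkL : kL ≤ k + 2) (hkR : kR ≤ k + 2) (hk : k + 3 ≤ kL + kR)
    (hp : p = k + 1 - kR' + 1) (hK : p + K = kL' + 1)
    (hbs : ∀ j, k + 2 - kR + 1 ≤ j → j < kL → b j < b (j + 1))
    (hbd : ∀ j, k + 2 - kR + 1 ≤ j → j ≤ kL → j ≤ b j ∧ b j ≤ m + j) :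
    (-1) ^ (k + 2 - kR).choose 2 *
        pairCoeff (k + 2) (pentCap (k + 2) kL kR) (pentExp m (k + 2) kL kR b) =
      ∑ c ∈ interlacing p (pentExp m (k + 2) kL kR b) K, (-1) ^ (k + 1 - kR').choose 2 *
        pairCoeff (k + 1) (pentCap (k + 1) kL' kR') (pentExp (m + 1) (k + 1) kL' kR' c) := by
  have hsign : (-1 : ℚ) ^ (k + 2 - kR).choose 2 * (-1) ^ (p - 1) =
      (-1) ^ (k + 1 - kR').choose 2 := by
    rcases Nat.lt_or_ge kR (k + 2) with h | h
    · rw [show k + 2 - kR = (k + 1 - kR') + 1 by omega, show p - 1 = k + 1 - kR' by omega,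
        Nat.choose_succ_succ', Nat.choose_one_right, pow_add, mul_right_comm, ← pow_add,
        (Even.add_self _).neg_one_pow, one_mul]
    · rw [show k + 2 - kR = 0 by omega, show p - 1 = 0 by omega, show k + 1 - kR' = 0 by omega]
      simp
  rw [← Finset.mul_sum, pairCoeff_succ_eq_sum_interlacing (p := p) (K := K)
    (d' := pentCap (k + 1) kL' kR') (by omega) (by omega)
    (fun i _ => pentExp_lt_succ hL hR hkL hkR hk hp hK hbs hbd i), ← mul_assoc, hsign]
  · congr 1
    refine Finset.sum_congr rfl fun c _ => pairCoeff_congr (fun _ _ _ => rfl) fun i _ _ => ?_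
    simp only [splice, skipAt, pentExp]
    split_ifs <;> omega
  all_goals
    intros
    simp only [pentCap]
    split_ifs <;> omega

/-- The pentagons with prescribed bottom row. -/
def pentSet (m n kL kR : ℕ) (b : ℕ → ℕ) : Set (ℕ → ℕ → ℤ) :=
  {a | IsPent m n kL kR a ∧ ∀ j ∈ Finset.Icc (n - kR + 1) kL, a n j = (b j : ℤ)}

/-- Put the row `b` (restricted to `[l, r]`) in place of the `n`-th row. -/
def appendRow (n l r : ℕ) (b : ℕ → ℕ) (a : ℕ → ℕ → ℤ) (i j : ℕ) : ℤ :=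
  if i = n then (if l ≤ j ∧ j ≤ r then (b j : ℤ) else 0) else a i j

theorem pentPos_min_iff (hL : kL' = min kL (k + 1)) (hR : kR' = min kR (k + 1)) (i j : ℕ) :
    PentPos (k + 1) kL' kR' i j ↔ PentPos (k + 2) kL kR i j ∧ i ≠ k + 2 := by
  simp only [PentPos]
  omega

theorem pentExp_le_of_mem_pentSet {a : ℕ → ℕ → ℤ} (hL : kL' = min kL (k + 1))
    (hR : kR' = min kR (k + 1)) (hkL : kL ≤ k + 2) (hkR : kR ≤ k + 2)
    (ha : a ∈ pentSet m (k + 2) kL kR b) {j : ℕ} (h1 : k + 1 - kR' + 1 ≤ j) (h2 : j ≤ kL') :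
    (pentExp m (k + 2) kL kR b j : ℤ) ≤ a (k + 1) j ∧
      a (k + 1) j ≤ (pentExp m (k + 2) kL kR b (j + 1) : ℤ) := by
  obtain ⟨⟨h, hNE, hSE, -, -⟩, hb⟩ := ha
  have h0 : PentPos (k + 2) kL kR (k + 1) j := by simp only [PentPos]; omega
  have hj := h _ _ h0
  constructor
  · rw [pentExp]
    split_ifs with h3 h4
    · exact hj.1
    · rw [← hb j (by rw [Finset.mem_Icc]; omega)]
      exact hNE _ _ h0 (by simp only [PentPos]; omega)
    · omega
  · rw [pentExp]
    split_ifs with h3 h4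
    · omega
    · rw [← hb (j + 1) (by rw [Finset.mem_Icc]; omega)]
      exact hSE _ _ h0 (by simp only [PentPos]; omega)
    · refine hj.2.trans ?_
      rw [Nat.cast_le]
      omega

theorem mem_pentSet_succ_iff (hL : kL' = min kL (k + 1)) (hR : kR' = min kR (k + 1))
    (hkL : kL ≤ k + 2) (hkR : kR ≤ k + 2)
    (hp : p = k + 1 - kR' + 1) (hK : p + K = kL' + 1)
    (hbs : ∀ j, k + 2 - kR + 1 ≤ j → j < kL → b j < b (j + 1))
    (hbd : ∀ j, k + 2 - kR + 1 ≤ j → j ≤ kL → j ≤ b j ∧ b j ≤ m + j) (a : ℕ → ℕ → ℤ) :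
    a ∈ pentSet m (k + 2) kL kR b ↔
      ∃ c ∈ interlacing p (pentExp m (k + 2) kL kR b) K,
        ∃ a' ∈ pentSet (m + 1) (k + 1) kL' kR' c,
          appendRow (k + 2) (k + 2 - kR + 1) kL b a' = a := by
  have hpos := pentPos_min_iff (k := k) hL hR
  constructor
  · intro ha
    have hrow (j : ℕ) (h1 : p ≤ j) (h2 : j < p + K) :=
      pentExp_le_of_mem_pentSet hL hR hkL hkR ha (j := j) (by omega) (by omega)
    have hrow' (j : ℕ) (h1 : p ≤ j) (h2 : j < p + K) : ((a (k + 1) j).toNat : ℤ) = a (k + 1) j :=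
      Int.toNat_of_nonneg ((Int.natCast_nonneg _).trans (hrow j h1 h2).1)
    obtain ⟨⟨h, hNE, hSE, hlt, hz⟩, hb⟩ := ha
    refine ⟨splice p K (fun j => (a (k + 1) j).toNat) 0, ?_,
      fun i j => if i = k + 2 then 0 else a i j, ⟨⟨?_, ?_, ?_, ?_, ?_⟩, ?_⟩, ?_⟩
    · rw [mem_interlacing]
      refine ⟨fun j h1 h2 => ?_, fun j h1 h2 => ?_, fun j hj => ?_⟩
      · rw [splice, if_pos ⟨h1, h2⟩]
        have h3 := hrow j h1 h2
        rw [← hrow' j h1 h2] at h3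
        exact_mod_cast h3
      · rw [splice, splice, if_pos ⟨h1, by omega⟩, if_pos ⟨by omega, h2⟩]
        have h3 := hlt (k + 1) j (by simp only [PentPos]; omega) (by simp only [PentPos]; omega)
        rw [← hrow' j h1 (by omega), ← hrow' (j + 1) (by omega) h2] at h3
        exact_mod_cast h3
      · rw [splice, if_neg hj, Pi.zero_apply]
    · intro i j hij
      have hi := (hpos i j).1 hij
      have hi' := hij.2.1
      simp only [if_neg hi.2]
      rw [show m + 1 + (k + 1 - i) + j = m + (k + 2 - i) + j by omega]
      exact h i j hi.1
    · intro i j h1 h2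
      rw [hpos] at h1 h2
      simp only [if_neg h1.2, if_neg h2.2]
      exact hNE i j h1.1 h2.1
    · intro i j h1 h2
      rw [hpos] at h1 h2
      simp only [if_neg h1.2, if_neg h2.2]
      exact hSE i j h1.1 h2.1
    · intro i j h1 h2
      rw [hpos] at h1 h2
      simp only [if_neg h1.2]
      exact hlt i j h1.1 h2.1
    · intro i j hij
      rw [hpos] at hij
      by_cases hi : i = k + 2
      · simp [hi]
      · simp only [if_neg hi]
        exact hz i j fun h' => hij ⟨h', hi⟩
    · intro j hj
      rw [Finset.mem_Icc] at hj
      beta_reduce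
      rw [if_neg (by omega), splice, if_pos ⟨by omega, by omega⟩,
        hrow' j (by omega) (by omega)]
    · funext i j
      rw [appendRow]
      split_ifs with h1 h2
      · rw [h1, hb j (Finset.mem_Icc.2 h2)]
      · rw [hz]
        simp only [PentPos]
        omega
      · rfl
  · rintro ⟨c, hc, a', ⟨⟨h, hNE, hSE, hlt, hz⟩, hb⟩, rfl⟩
    rw [mem_interlacing] at hc
    obtain ⟨hc1, -, -⟩ := hc
    have hlast (j : ℕ) (h1 : k + 2 - kR + 1 ≤ j ∧ j ≤ kL) :
        appendRow (k + 2) (k + 2 - kR + 1) kL b a' (k + 2) j = b j := by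
      rw [appendRow, if_pos rfl, if_pos h1]
    have hne {i : ℕ} (hi : i ≠ k + 2) (j : ℕ) :
        appendRow (k + 2) (k + 2 - kR + 1) kL b a' i j = a' i j := if_neg hi
    have hB (j : ℕ) (h1 : k + 2 - kR + 1 ≤ j) (h2 : j ≤ kL) :
        pentExp m (k + 2) kL kR b j = b j := by
      rw [pentExp, if_neg (by omega), if_pos h2]
    refine ⟨⟨?_, ?_, ?_, ?_, ?_⟩, ?_⟩
    · intro i j hij
      by_cases hi : i = k + 2
      · subst hi
        have h1 : k + 2 - kR + 1 ≤ j ∧ j ≤ kL := by simp only [PentPos] at hij; omega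
        rw [hlast j h1]
        have := hbd j h1.1 h1.2
        omega
      · have h1 := (hpos i j).2 ⟨hij, hi⟩
        have h2 := h1.2.1
        rw [hne hi, show m + (k + 2 - i) + j = m + 1 + (k + 1 - i) + j by omega]
        exact h i j h1
    · intro i j h1 h2
      have hi : i ≠ k + 2 := by have := h2.2.1; omega
      rw [hne hi]
      by_cases hi' : i + 1 = k + 2
      · obtain rfl : i = k + 1 := by omega
        simp only [PentPos] at h1 h2
        rw [hlast j (by omega), hb j (by rw [Finset.mem_Icc]; omega), Nat.cast_le,
          ← hB j (by omega) (by omega)]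
        exact (hc1 j (by omega) (by omega)).1
      · rw [hne hi']
        exact hNE i j ((hpos _ _).2 ⟨h1, hi⟩) ((hpos _ _).2 ⟨h2, hi'⟩)
    · intro i j h1 h2
      have hi : i ≠ k + 2 := by have := h2.2.1; omega
      rw [hne hi]
      by_cases hi' : i + 1 = k + 2
      · obtain rfl : i = k + 1 := by omega
        simp only [PentPos] at h1 h2
        rw [hlast (j + 1) (by omega), hb j (by rw [Finset.mem_Icc]; omega), Nat.cast_le,
          ← hB (j + 1) (by omega) (by omega)]
        exact (hc1 j (by omega) (by omega)).2
      · rw [hne hi']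
        exact hSE i j ((hpos _ _).2 ⟨h1, hi⟩) ((hpos _ _).2 ⟨h2, hi'⟩)
    · intro i j h1 h2
      by_cases hi : i = k + 2
      · subst hi
        simp only [PentPos] at h1 h2
        rw [hlast j (by omega), hlast (j + 1) (by omega), Nat.cast_lt]
        exact hbs j (by omega) (by omega)
      · rw [hne hi, hne hi]
        exact hlt i j ((hpos _ _).2 ⟨h1, hi⟩) ((hpos _ _).2 ⟨h2, hi⟩)
    · intro i j hij
      by_cases hi : i = k + 2
      · subst hi
        rw [appendRow, if_pos rfl, if_neg]
        intro h1
        apply hij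
        simp only [PentPos]
        omega
      · rw [hne hi]
        exact hz i j fun h' => hij ((hpos i j).1 h').1
    · intro j hj
      exact hlast j (Finset.mem_Icc.1 hj)

end pentagons

theorem pentSet_one (m : ℕ) (b : ℕ → ℕ) (hb : 1 ≤ b 1 ∧ b 1 ≤ m + 1) :
    pentSet m 1 1 1 b = {appendRow 1 1 1 b 0} := by
  have hpos (i j : ℕ) : PentPos 1 1 1 i j ↔ i = 1 ∧ j = 1 := by simp only [PentPos]; omega
  ext a
  simp only [pentSet, IsPent, hpos, Set.mem_ofPred_eq, Set.mem_singleton_iff]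
  constructor
  · rintro ⟨⟨-, -, -, -, hz⟩, h⟩
    funext i j
    rw [appendRow]
    split_ifs with h1 h2
    · obtain rfl : j = 1 := by omega
      rw [h1, h 1 (by simp)]
    · exact hz i j (by omega)
    · exact hz i j (by omega)
  · rintro rfl
    refine ⟨⟨?_, by omega, by omega, by omega, ?_⟩, ?_⟩
    · rintro i j ⟨rfl, rfl⟩
      simp only [appendRow]
      simp
      omega
    · intro i j hij
      rw [appendRow]
      split_ifs
      · omega
      · rfl
      · rfl
    · intro j hj
      obtain rfl : j = 1 := by simpa using hj
      simp [appendRow]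

theorem pairCoeff_one {d c : ℕ → ℕ} (hd : d 1 = 0) : pairCoeff 1 d c = 1 := by
  rw [pairCoeff_succ 0 d c fun i h1 h2 => by rw [show i = 1 by omega, hd]]
  simp [hd, pairCoeff, coeffAt, pairPoly, pairProd, MvPolynomial.coeff_one,
    eq_iff_true_of_subsingleton]

theorem exists_finset_pentSet (k m kL kR : ℕ) (b : ℕ → ℕ) (hkL : kL ≤ k + 1) (hkR : kR ≤ k + 1)
    (hk : k + 2 ≤ kL + kR) (hbs : ∀ j, k + 1 - kR + 1 ≤ j → j < kL → b j < b (j + 1))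
    (hbd : ∀ j, k + 1 - kR + 1 ≤ j → j ≤ kL → j ≤ b j ∧ b j ≤ m + j) :
    ∃ T : Finset (ℕ → ℕ → ℤ), (T : Set (ℕ → ℕ → ℤ)) = pentSet m (k + 1) kL kR b ∧
      (T.card : ℚ) = (-1) ^ (k + 1 - kR).choose 2 *
        pairCoeff (k + 1) (pentCap (k + 1) kL kR) (pentExp m (k + 1) kL kR b) := by
  classical
  induction k generalizing m kL kR b with
  | zero =>
    obtain rfl : kL = 1 := by omega
    obtain rfl : kR = 1 := by omega
    refine ⟨{appendRow 1 1 1 b 0}, ?_, ?_⟩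
    · rw [pentSet_one m b (hbd 1 (by simp) le_rfl), Finset.coe_singleton]
    · rw [pairCoeff_one (by simp [pentCap])]
      simp
  | succ k ih =>
    obtain ⟨kL', hL⟩ : ∃ kL', kL' = min kL (k + 1) := ⟨_, rfl⟩
    obtain ⟨kR', hR⟩ : ∃ kR', kR' = min kR (k + 1) := ⟨_, rfl⟩
    obtain ⟨p, hp⟩ : ∃ p, p = k + 1 - kR' + 1 := ⟨_, rfl⟩
    obtain ⟨K, hK⟩ : ∃ K, p + K = kL' + 1 := ⟨kL' + 1 - p, by omega⟩
    have hT (c : ℕ → ℕ) (hc : c ∈ interlacing p (pentExp m (k + 2) kL kR b) K) :=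
      ih (m + 1) kL' kR' c (by omega) (by omega) (by omega)
        (fun j h1 h2 => ((mem_interlacing _ _ _ _).1 hc).2.1 j (by omega) (by omega))
        (fun j h1 h2 => by
          have h3 := ((mem_interlacing _ _ _ _).1 hc).1 j (by omega) (by omega)
          have h4 := hbd j
          have h5 := hbd (j + 1)
          simp only [pentExp] at h3
          split_ifs at h3 <;> omega)
    choose! T hT hcard using hT
    have hinj : ∀ c ∈ interlacing p (pentExp m (k + 2) kL kR b) K, Set.InjOn
        (appendRow (k + 2) (k + 2 - kR + 1) kL b) (T c) := by
      intro c hc a ha a' ha' h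
      rw [hT c hc] at ha ha'
      funext i j
      by_cases hi : i = k + 2
      · have hnot : ¬ PentPos (k + 1) kL' kR' i j := by simp only [PentPos]; omega
        rw [ha.1.2.2.2.2 i j hnot, ha'.1.2.2.2.2 i j hnot]
      · simpa [appendRow, hi] using congrFun₂ h i j
    refine ⟨(interlacing p (pentExp m (k + 2) kL kR b) K).biUnion fun c =>
      (T c).image (appendRow (k + 2) (k + 2 - kR + 1) kL b), ?_, ?_⟩
    · ext a
      rw [mem_pentSet_succ_iff hL hR hkL hkR hp hK hbs hbd, Finset.mem_coe, Finset.mem_biUnion]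
      refine exists_congr fun c => and_congr_right fun hc => ?_
      rw [Finset.mem_image, ← hT c hc]
      simp only [Finset.mem_coe]
    · rw [pairCoeff_pentExp hL hR hkL hkR hk hp hK hbs hbd, Finset.card_biUnion, Nat.cast_sum]
      · refine Finset.sum_congr rfl fun c hc => ?_
        rw [Finset.card_image_of_injOn (hinj c hc), hcard c hc]
      · intro c hc c' hc' hne
        rw [Function.onFun, Finset.disjoint_left]
        intro a ha ha'
        rw [Finset.mem_image] at ha ha'
        obtain ⟨a₁, h1, rfl⟩ := ha
        obtain ⟨a₂, h2, h⟩ := ha'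
        rw [← Finset.mem_coe, hT _ hc] at h1
        rw [← Finset.mem_coe, hT _ hc'] at h2
        apply hne
        funext j
        by_cases hj : p ≤ j ∧ j < p + K
        · have h3 := congrFun₂ h (k + 1) j
          simp only [appendRow, if_neg (show k + 1 ≠ k + 2 by omega)] at h3
          rw [h1.2 j (by rw [Finset.mem_Icc]; omega), h2.2 j (by rw [Finset.mem_Icc]; omega)] at h3
          exact_mod_cast h3.symm
        · rw [((mem_interlacing _ _ _ _).1 hc).2.2 j hj,
            ((mem_interlacing _ _ _ _).1 hc').2.2 j hj]

section transfer

open MvPolynomial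

theorem prod_Icc_blocks {M : Type*} [CommMonoid M] {n kL kR : ℕ} (hkL : kL ≤ n)
    (hk : n ≤ kL + kR) (f g h : ℕ → M) :
    (∏ i ∈ Finset.Icc 1 (n - kR), f i) * (∏ i ∈ Finset.Icc (n - kR + 1) kL, g i) *
        ∏ i ∈ Finset.Icc (kL + 1) n, h i =
      ∏ i : Fin n, if (i : ℕ) + 1 ≤ n - kR then f (i + 1) else
        if (i : ℕ) + 1 ≤ kL then g (i + 1) else h (i + 1) := by
  rw [Fin.prod_univ_eq_prod_range (fun i => if i + 1 ≤ n - kR then f (i + 1) else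
      if i + 1 ≤ kL then g (i + 1) else h (i + 1)), Finset.range_eq_Ico,
    Finset.prod_Ico_add' (fun i => if i ≤ n - kR then f i else if i ≤ kL then g i else h i) 0 n 1,
    ← Finset.prod_Ico_consecutive _ (show 0 + 1 ≤ kL + 1 by omega) (by omega),
    ← Finset.prod_Ico_consecutive _ (show 0 + 1 ≤ n - kR + 1 by omega) (by omega)]
  congr 1
  · congr 1
    · refine Finset.prod_congr (by ext; rw [Finset.mem_Icc, Finset.mem_Ico]; omega) fun i hi => ?_
      rw [Finset.mem_Ico] at hi
      rw [if_pos (by omega)]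
    · refine Finset.prod_congr (by ext; rw [Finset.mem_Icc, Finset.mem_Ico]; omega) fun i hi => ?_
      rw [Finset.mem_Ico] at hi
      rw [if_neg (by omega), if_pos (by omega)]
  · refine Finset.prod_congr (by ext; rw [Finset.mem_Icc, Finset.mem_Ico]; omega) fun i hi => ?_
    rw [Finset.mem_Ico] at hi
    rw [if_neg (by omega), if_neg (by omega)]

theorem rename_pairPoly (n : ℕ) :
    rename (fun i : Fin n => (i : ℕ) + 1) (pairPoly n) =
      ∏ p ∈ (Finset.Icc 1 n ×ˢ Finset.Icc 1 n).filter (fun p => p.1 < p.2),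
        ((X p.1 - X p.2) * (1 + X p.2 + X p.1 * X p.2) : MvPolynomial ℕ ℚ) := by
  rw [pairPoly, map_pairProd, Finset.prod_filter, Finset.prod_product, pairProd]
  have h (f : ℕ → MvPolynomial ℕ ℚ) : ∏ i ∈ Finset.Icc 1 n, f i = ∏ i : Fin n, f (i + 1) := by
    rw [Fin.prod_univ_eq_prod_range (fun i => f (i + 1)), Finset.range_eq_Ico,
      Finset.prod_Ico_add' f 0 n 1]
    exact Finset.prod_congr (by ext; rw [Finset.mem_Icc, Finset.mem_Ico]; omega) fun _ _ => rfl
  simp only [h, pairFactor, map_mul, map_sub, map_add, map_one, rename_X, Fin.lt_def,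
    add_lt_add_iff_right]

theorem pentDeg_eq_mapDomain {n kL kR : ℕ} (hkL : kL ≤ n) (hk : n + 1 ≤ kL + kR) :
    pentDeg n kL kR = Finsupp.mapDomain (fun i : Fin n => (i : ℕ) + 1)
      (Finsupp.equivFunOnFinite.symm fun i => pentCap n kL kR (i + 1)) := by
  have hinj : Function.Injective fun i : Fin n => (i : ℕ) + 1 := fun i j h => by
    simpa [Fin.ext_iff] using h
  have hsum (s : Finset ℕ) (f : ℕ → ℕ) (i : ℕ) :
      (∑ j ∈ s, Finsupp.single j (f j)) i = if i ∈ s then f i else 0 := by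
    rw [Finsupp.finsetSum_apply]
    simp [Finsupp.single_apply]
  ext i
  rw [pentDeg, Finsupp.add_apply, Finsupp.add_apply, hsum, hsum, hsum]
  simp only [Finset.mem_Icc]
  by_cases hi : 1 ≤ i ∧ i ≤ n
  · obtain ⟨j, rfl⟩ : ∃ j : Fin n, i = j + 1 := ⟨⟨i - 1, by omega⟩, by simp; omega⟩
    rw [Finsupp.mapDomain_apply hinj]
    simp only [Finsupp.equivFunOnFinite_symm_apply_apply, pentCap]
    split_ifs <;> omega
  · rw [Finsupp.mapDomain_of_notMem_range]
    · split_ifs <;> omega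
    · rintro ⟨j, rfl⟩
      exact hi ⟨by simp, j.2⟩

theorem coeff_pentDeg {n kL kR : ℕ} (m : ℕ) (b : ℕ → ℕ) (hkL : kL ≤ n) (hk : n + 1 ≤ kL + kR) :
    coeff (pentDeg n kL kR)
        ((∏ i ∈ Finset.Icc 1 (n - kR), (1 + X i) ^ i) *
          (∏ i ∈ Finset.Icc (n - kR + 1) kL, (1 + X i) ^ b i) *
          (∏ i ∈ Finset.Icc (kL + 1) n, (1 + X i) ^ (m + kL + 1)) *
          ∏ p ∈ (Finset.Icc 1 n ×ˢ Finset.Icc 1 n).filter (fun p => p.1 < p.2),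
            ((X p.1 - X p.2) * (1 + X p.2 + X p.1 * X p.2) : MvPolynomial ℕ ℚ)) =
      pairCoeff n (pentCap n kL kR) (pentExp m n kL kR b) := by
  have hinj : Function.Injective fun i : Fin n => (i : ℕ) + 1 := fun i j h => by
    simpa [Fin.ext_iff] using h
  rw [pairCoeff, coeffAt, ← coeff_rename_mapDomain _ hinj, ← pentDeg_eq_mapDomain hkL hk,
    map_mul, rename_pairPoly, prod_Icc_blocks hkL (by omega)]
  congr 2
  rw [map_prod]
  refine Finset.prod_congr rfl fun i _ => ?_
  rw [map_pow, map_add, map_one, rename_X, pentExp]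
  split_ifs <;> rfl

end transfer

/-- The number of `(m,n,k_L,k_R)`-Gog pentagons with bottom row `(b_{n−k_R+1},…,b_{k_L})`
(a sequence that occurs as the bottom row of at least one such pentagon) is the constant term of
`(−1)^{C(n−k_R,2)} ∏_{i=1}^{n−k_R} (1+x_i)^i x_i^{1−k_R−i}
 ∏_{i=n−k_R+1}^{k_L} (1+x_i)^{b_i} x_i^{−n+1} ∏_{i=k_L+1}^{n} (1+x_i)^{m+k_L+1} x_i^{−n+i−k_L}
 ∏_{1≤i<j≤n} (x_i−x_j)(1+x_j+x_i x_j)`. -/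
theorem stmt11 (m n kL kR : ℕ) (hkL : kL ≤ n) (hkR : kR ≤ n) (hkk : n + 1 ≤ kL + kR)
    (b : ℕ → ℤ)
    (hbs : ∀ j, n - kR + 1 ≤ j → j < kL → b j < b (j+1))
    (hbd : ∀ j, n - kR + 1 ≤ j → j ≤ kL → (j : ℤ) ≤ b j ∧ b j ≤ (m : ℤ) + j)
    (hex : ∃ a : ℕ → ℕ → ℤ, IsPent m n kL kR a ∧
      ∀ j ∈ Finset.Icc (n - kR + 1) kL, a n j = b j) :
    (Set.ncard {a : ℕ → ℕ → ℤ | IsPent m n kL kR a ∧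
        ∀ j ∈ Finset.Icc (n - kR + 1) kL, a n j = b j} : ℚ) =
    (-1 : ℚ) ^ ((n - kR).choose 2) *
      MvPolynomial.coeff (pentDeg n kL kR)
        ((∏ i ∈ Finset.Icc 1 (n - kR), (1 + MvPolynomial.X i) ^ i) *
          (∏ i ∈ Finset.Icc (n - kR + 1) kL, (1 + MvPolynomial.X i) ^ (b i).toNat) *
          (∏ i ∈ Finset.Icc (kL + 1) n, (1 + MvPolynomial.X i) ^ (m + kL + 1)) *
          ∏ p ∈ (Finset.Icc 1 n ×ˢ Finset.Icc 1 n).filter (fun p => p.1 < p.2),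
            ((MvPolynomial.X p.1 - MvPolynomial.X p.2) *
              (1 + MvPolynomial.X p.2 + MvPolynomial.X p.1 * MvPolynomial.X p.2) :
              MvPolynomial ℕ ℚ)) := by
  obtain ⟨k, rfl⟩ : ∃ k, n = k + 1 := ⟨n - 1, by omega⟩
  have hb (j : ℕ) (h1 : k + 1 - kR + 1 ≤ j) (h2 : j ≤ kL) : ((b j).toNat : ℤ) = b j :=
    Int.toNat_of_nonneg ((Int.natCast_nonneg j).trans (hbd j h1 h2).1)
  obtain ⟨T, hT, hcard⟩ := exists_finset_pentSet k m kL kR (fun j => (b j).toNat) hkL hkR hkk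
    (fun j h1 h2 => by
      have := hbs j h1 h2
      have := hb j h1 h2.le
      have := hb (j + 1) (by omega) h2
      omega)
    (fun j h1 h2 => by
      have := hbd j h1 h2
      have := hb j h1 h2
      omega)
  rw [coeff_pentDeg m (fun j => (b j).toNat) hkL hkk, ← hcard, ← Set.ncard_coe_finset, hT]
  congr 2
  ext a
  refine and_congr_right fun _ => forall₂_congr fun j hj => ?_
  rw [Finset.mem_Icc] at hj
  rw [hb j hj.1 hj.2]
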